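/- Let n ≥ 2 be an integer, let α ∈ (0,1), and let s, t > 0 satisfy (1−α)s + t − 1 ≥ 0. Let w ∈ (0,1) be the smaller root of the quadratic w² − (s + 1 + (α/(1−α))t)w + s = 0 and set g = αs/((1−α)(s−w)). Let θ ∈ ℝ^n be such that 1, θ_1, …, θ_n are linearly independent over ℚ, and let (z_l) be a sequence of best approximations to θ. Then for every c₀ > 0 there exists c₁ > 0 (depending only on n, θ, α, s, t, c₀) with the following property: whenever ν < k are indices such that (i) z_{ν−1}, z_ν, z_{ν+1} are linearly independent and z_{k−1}, z_k, z_{k+1} are linearly independent, (ii) the subgroup of ℤ^{n+1} generated by z_ν, z_{ν+1} equals the subgroup generated by z_{k−1}, z_k (call it Λ), (iii) ξ_j ≤ q_{j+1}^{−α} for each j ∈ {ν−1, ν, k−1, k}, and (iv) (det 𝔖₋)^s · (det 𝔖₊)^t ≥ c₀ · det Λ, where 𝔖₋ = span_ℝ(z_{ν−1},z_ν,z_{ν+1}) ∩ ℤ^{n+1} and 𝔖₊ = span_ℝ(z_{k−1},z_k,z_{k+1}) ∩ ℤ^{n+1}, then q_{ν+1} ≥ c₁ q_ν^g or q_{k+1}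 ≥ c₁ q_k^g. -/

import Mathlib

open scoped BigOperators

noncomputable section

/-- The real vector attached to an integer vector. -/
def vecR {m : ℕ} (z : Fin m → ℤ) : Fin m → ℝ := fun i => (z i : ℝ)

/-- The approximation error `ξ = max_i |q θ_i - a_i|` of a vector
`z = (q, a_1, …, a_n) ∈ ℤ^(n+1)`. -/
def xi {n : ℕ} (θ : Fin n → ℝ) (z : Fin (n + 1) → ℤ) : ℝ :=
  ⨆ i : Fin n, |(z 0 : ℝ) * θ i - (z i.succ : ℝ)|

/-- A sequence of best approximations to `θ` for simultaneous approximation: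
`z l = (q_l, a_{1,l}, …, a_{n,l})`, `q_l > 0`, `(q_l)` strictly increasing,
`(ξ_l)` strictly decreasing, and any `q` with `0 < q < q_{l+1}` approximates
no better than `ξ_l`. -/
def IsBestApproxSeq {n : ℕ} (θ : Fin n → ℝ) (z : ℕ → Fin (n + 1) → ℤ) : Prop :=
  (∀ l, 0 < z l 0) ∧
  (StrictMono fun l => z l 0) ∧
  (StrictAnti fun l => xi θ (z l)) ∧
  ∀ l : ℕ, ∀ q : ℤ, 0 < q → q < z (l + 1) 0 → ∀ a : Fin n → ℤ,
    xi θ (z l) ≤ ⨆ i : Fin n, |(q : ℝ) * θ i - (a i : ℝ)|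

/-- Gram matrix of a family of vectors in `ℝ^m` (standard inner product). -/
def gram {r m : ℕ} (v : Fin r → Fin m → ℝ) : Matrix (Fin r) (Fin r) ℝ :=
  Matrix.of (fun i j => ∑ k, v i k * v j k)

/-- Covolume (volume of a fundamental parallelepiped) of the lattice generated
by a linearly independent family of vectors of `ℝ^m`. -/
def covol {r m : ℕ} (v : Fin r → Fin m → ℝ) : ℝ := Real.sqrt (gram v).det

/-- The subgroup of integer points of `ℝ^m`. -/
def intPoints (m : ℕ) : AddSubgroup (Fin m → ℝ) where
  carrier := {v | ∀ i, ∃ k : ℤ, v i = (k : ℝ)}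
  zero_mem' := fun i => ⟨0, by simp⟩
  add_mem' := by
    intro a b ha hb i
    obtain ⟨p, hp⟩ := ha i
    obtain ⟨q, hq⟩ := hb i
    exact ⟨p + q, by simp [hp, hq]⟩
  neg_mem' := by
    intro a ha i
    obtain ⟨p, hp⟩ := ha i
    exact ⟨-p, by simp [hp]⟩

open scoped Classical in
/-- Covolume (fundamental volume) of a subgroup of `ℝ^m` generated by some
linearly independent family of vectors; junk value `0` otherwise. -/
def latticeDet {m : ℕ} (Γ : AddSubgroup (Fin m → ℝ)) : ℝ :=
  if h : ∃ r : ℕ, ∃ v : Fin r → Fin m → ℝ, LinearIndependent ℝ v ∧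
      AddSubgroup.closure (Set.range v) = Γ
  then covol h.choose_spec.choose
  else 0

lemma gram_sum_smul {r s m : ℕ} (M : Matrix (Fin r) (Fin s) ℝ) (v : Fin s → Fin m → ℝ) :
    gram (fun i => ∑ j, M i j • v j) = M * gram v * M.transpose := by
  have h : ∀ {r : ℕ} (u : Fin r → Fin m → ℝ),
      gram u = Matrix.of u * (Matrix.of u).transpose := by
    intro r u
    ext i j
    simp [gram, Matrix.mul_apply]
  have hM : Matrix.of (fun i => ∑ j, M i j • v j) = M * Matrix.of v := by
    ext i k
    simp [Matrix.mul_apply]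
  rw [h, h, hM, Matrix.transpose_mul]
  simp only [Matrix.mul_assoc]

lemma det_gram_sum_smul {r m : ℕ} (M : Matrix (Fin r) (Fin r) ℝ) (v : Fin r → Fin m → ℝ) :
    (gram (fun i => ∑ j, M i j • v j)).det = M.det ^ 2 * (gram v).det := by
  rw [gram_sum_smul, Matrix.det_mul, Matrix.det_mul, Matrix.det_transpose]
  ring

/-- A weak form of Hadamard's inequality for Gram determinants. -/
lemma det_gram_le {r m : ℕ} (v : Fin r → Fin m → ℝ) (B : Fin r → ℝ)
    (hB : ∀ i k, |v i k| ≤ B i) :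
    (gram v).det ≤ r.factorial * (m : ℝ) ^ r * (∏ i, B i) ^ 2 := by
  rcases Nat.eq_zero_or_pos m with rfl | hm
  · rcases Nat.eq_zero_or_pos r with rfl | hr
    · simp
    · have : gram v = 0 := by ext; simp [gram]
      have : Nonempty (Fin r) := ⟨⟨0, hr⟩⟩
      simp [*, hr.ne']
  have hB0 : ∀ i, 0 ≤ B i := fun i => (abs_nonneg _).trans (hB i ⟨0, hm⟩)
  have hG : ∀ i j, |gram v i j| ≤ m * (B i * B j) := by
    intro i j
    calc |gram v i j| ≤ ∑ k, |v i k * v j k| :=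
          Finset.abs_sum_le_sum_abs (fun k => v i k * v j k) Finset.univ
      _ ≤ ∑ _k : Fin m, B i * B j := by
          refine Finset.sum_le_sum fun k _ => ?_
          rw [abs_mul]
          exact mul_le_mul (hB i k) (hB j k) (abs_nonneg _) (hB0 i)
      _ = m * (B i * B j) := by simp
  rw [Matrix.det_apply]
  have hterm : ∀ σ : Equiv.Perm (Fin r),
      Equiv.Perm.sign σ • ∏ i, gram v (σ i) i ≤ (m : ℝ) ^ r * (∏ i, B i) ^ 2 := by
    intro σ
    calc Equiv.Perm.sign σ • ∏ i, gram v (σ i) i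
        ≤ |Equiv.Perm.sign σ • ∏ i, gram v (σ i) i| := le_abs_self _
      _ = ∏ i, |gram v (σ i) i| := by
          rcases Int.units_eq_one_or (Equiv.Perm.sign σ) with h | h <;>
            simp [h, Finset.abs_prod]
      _ ≤ ∏ i, (m * (B (σ i) * B i)) :=
          Finset.prod_le_prod (fun _ _ => abs_nonneg _) fun i _ => hG _ _
      _ = (m : ℝ) ^ r * (∏ i, B i) ^ 2 := by
          rw [Finset.prod_mul_distrib, Finset.prod_mul_distrib, Equiv.prod_comp σ B]
          simp [sq]
  calc _ ≤ ∑ _σ : Equiv.Perm (Fin r), (m : ℝ) ^ r * (∏ i, B i) ^ 2 :=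
        Finset.sum_le_sum fun σ _ => hterm σ
    _ = _ := by simp [Fintype.card_perm, mul_assoc]

lemma sq_minor_le_det_gram {m : ℕ} (v : Fin 2 → Fin m → ℝ) (i j : Fin m) :
    (v 0 i * v 1 j - v 0 j * v 1 i) ^ 2 ≤ (gram v).det := by
  have hL : ∑ a, ∑ b, (v 0 a * v 1 b - v 0 b * v 1 a) ^ 2 = 2 * (gram v).det := by
    have : ∀ a b, (v 0 a * v 1 b - v 0 b * v 1 a) ^ 2 =
        (v 0 a * v 0 a) * (v 1 b * v 1 b) + (v 1 a * v 1 a) * (v 0 b * v 0 b)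
          - 2 * ((v 0 a * v 1 a) * (v 0 b * v 1 b)) := by
      intro a b; ring
    simp only [this, Finset.sum_sub_distrib, Finset.sum_add_distrib, ← Finset.mul_sum,
      ← Finset.sum_mul, Matrix.det_fin_two, gram, Matrix.of_apply]
    simp only [mul_comm (v 1 _) (v 0 _)]
    ring
  rcases eq_or_ne i j with rfl | hij
  · have : 0 ≤ ∑ a, ∑ b, (v 0 a * v 1 b - v 0 b * v 1 a) ^ 2 := by positivity
    nlinarith
  have h1 : ∀ a b, (v 0 a * v 1 b - v 0 b * v 1 a) ^ 2 ≤
      ∑ b, (v 0 a * v 1 b - v 0 b * v 1 a) ^ 2 := fun a b =>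
    Finset.single_le_sum (f := fun b => (v 0 a * v 1 b - v 0 b * v 1 a) ^ 2)
      (fun _ _ => sq_nonneg _) (Finset.mem_univ b)
  have h2 : ∑ b, (v 0 i * v 1 b - v 0 b * v 1 i) ^ 2 + ∑ b, (v 0 j * v 1 b - v 0 b * v 1 j) ^ 2 ≤
      ∑ a, ∑ b, (v 0 a * v 1 b - v 0 b * v 1 a) ^ 2 := by
    rw [← Finset.sum_pair (f := fun a => ∑ b, (v 0 a * v 1 b - v 0 b * v 1 a) ^ 2) hij]
    exact Finset.sum_le_sum_of_subset_of_nonneg (Finset.subset_univ _)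
      fun _ _ _ => by positivity
  nlinarith [h1 i j, h1 j i]

lemma abs_minor_le_covol {m : ℕ} (v : Fin 2 → Fin m → ℝ) (i j : Fin m) :
    |v 0 i * v 1 j - v 0 j * v 1 i| ≤ covol v :=
  Real.abs_le_sqrt (sq_minor_le_det_gram v i j)

/-- Passing to a subgroup of finite index does not decrease the covolume. -/
lemma covol_le_covol {r s m : ℕ} {v : Fin r → Fin m → ℝ} {w : Fin s → Fin m → ℝ}
    (hv : LinearIndependent ℝ v) (hw : LinearIndependent ℝ w)
    (hwv : ∀ i, w i ∈ AddSubgroup.closure (Set.range v))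
    (hvw : ∀ i, v i ∈ Submodule.span ℝ (Set.range w)) : covol v ≤ covol w := by
  have hint : ∀ i, ∃ c : Fin r → ℤ, ∑ j, c j • v j = w i := by
    intro i
    have := hwv i
    rwa [← Submodule.span_int_eq_addSubgroupClosure, Submodule.mem_toAddSubgroup,
      Submodule.mem_span_range_iff_exists_fun] at this
  choose M hM using hint
  have hspan : Submodule.span ℝ (Set.range v) = Submodule.span ℝ (Set.range w) := by
    apply le_antisymm
    · rw [Submodule.span_le]
      rintro _ ⟨i, rfl⟩
      exact hvw i
    · rw [Submodule.span_le]
      rintro _ ⟨i, rfl⟩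
      rw [← hM i]
      exact Submodule.sum_mem _ fun j _ =>
        zsmul_mem (Submodule.subset_span (Set.mem_range_self j)) _
  have hrs : r = s := by
    have h1 := finrank_span_eq_card hv
    have h2 := finrank_span_eq_card hw
    rw [hspan, h2] at h1
    simpa using h1.symm
  subst hrs
  let N : Matrix (Fin r) (Fin r) ℤ := Matrix.of M
  let NR : Matrix (Fin r) (Fin r) ℝ := N.map (Int.castRingHom ℝ)
  have hwN : w = fun i => ∑ j, NR i j • v j := by
    ext i k
    rw [← hM i]
    simp [NR, N]
  have hdet : NR.det = (N.det : ℝ) := by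
    exact (RingHom.map_det (Int.castRingHom ℝ) N).symm
  have hne : NR.det ≠ 0 := by
    intro h0
    obtain ⟨x, hx, hx0⟩ := Matrix.exists_vecMul_eq_zero_iff.mpr h0
    apply hx
    ext i
    refine Fintype.linearIndependent_iff.mp hw x ?_ i
    rw [hwN]
    simp only [Finset.smul_sum, smul_smul]
    rw [Finset.sum_comm]
    refine Finset.sum_eq_zero fun j _ => ?_
    rw [← Finset.sum_smul]
    have := congrFun hx0 j
    simp only [Matrix.vecMul, dotProduct, Pi.zero_apply] at this
    rw [this, zero_smul]
  have h1 : (1 : ℝ) ≤ NR.det ^ 2 := by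
    rw [hdet] at hne ⊢
    have : N.det ≠ 0 := by exact_mod_cast hne
    have : 1 ≤ N.det ^ 2 := by
      have := sq_pos_of_ne_zero this
      omega
    exact_mod_cast this
  unfold covol
  rcases le_total (gram v).det 0 with h | h
  · rw [Real.sqrt_eq_zero_of_nonpos h]
    exact Real.sqrt_nonneg _
  · apply Real.sqrt_le_sqrt
    rw [hwN, det_gram_sum_smul]
    nlinarith

lemma exists_latticeDet_eq_covol {m : ℕ} {Γ : AddSubgroup (Fin m → ℝ)}
    (h : ∃ r : ℕ, ∃ v : Fin r → Fin m → ℝ, LinearIndependent ℝ v ∧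
      AddSubgroup.closure (Set.range v) = Γ) :
    ∃ r : ℕ, ∃ v : Fin r → Fin m → ℝ, LinearIndependent ℝ v ∧
      AddSubgroup.closure (Set.range v) = Γ ∧ latticeDet Γ = covol v :=
  ⟨_, h.choose_spec.choose, h.choose_spec.choose_spec.1, h.choose_spec.choose_spec.2, dif_pos h⟩

lemma latticeDet_le_covol {s m : ℕ} {Γ : AddSubgroup (Fin m → ℝ)} {w : Fin s → Fin m → ℝ}
    (hw : LinearIndependent ℝ w) (hwΓ : ∀ i, w i ∈ Γ)
    (hΓ : ∀ x ∈ Γ, x ∈ Submodule.span ℝ (Set.range w)) : latticeDet Γ ≤ covol w := by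
  by_cases h : ∃ r : ℕ, ∃ v : Fin r → Fin m → ℝ, LinearIndependent ℝ v ∧
      AddSubgroup.closure (Set.range v) = Γ
  · obtain ⟨r, v, hv, hcl, hdet⟩ := exists_latticeDet_eq_covol h
    rw [hdet]
    exact covol_le_covol hv hw (fun i => hcl.ge (hwΓ i)) fun i =>
      hΓ _ (hcl.le (AddSubgroup.subset_closure (Set.mem_range_self i)))
  · rw [latticeDet, dif_neg h]
    exact Real.sqrt_nonneg _

lemma latticeDet_nonneg {m : ℕ} (Γ : AddSubgroup (Fin m → ℝ)) : 0 ≤ latticeDet Γ := by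
  unfold latticeDet
  split_ifs
  · exact Real.sqrt_nonneg _
  · exact le_rfl

lemma closure_le_span {m : ℕ} (S : Set (Fin m → ℝ)) :
    AddSubgroup.closure S ≤ (Submodule.span ℝ S).toAddSubgroup :=
  (AddSubgroup.closure_le _).mpr Submodule.subset_span

lemma latticeDet_closure {s m : ℕ} {w : Fin s → Fin m → ℝ} (hw : LinearIndependent ℝ w) :
    latticeDet (AddSubgroup.closure (Set.range w)) = covol w := by
  apply le_antisymm
  · exact latticeDet_le_covol hw
      (fun i => AddSubgroup.subset_closure (Set.mem_range_self i)) fun x hx => closure_le_span _ hx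
  · obtain ⟨r, v, hv, hcl, hdet⟩ :=
      exists_latticeDet_eq_covol (Γ := AddSubgroup.closure (Set.range w)) ⟨s, w, hw, rfl⟩
    rw [hdet]
    exact covol_le_covol hw hv
      (fun i => hcl.le (AddSubgroup.subset_closure (Set.mem_range_self i)))
      fun i => closure_le_span _ (hcl.ge (AddSubgroup.subset_closure (Set.mem_range_self i)))

/-- The vector of errors `q θ_i - a_i` of `z = (q, a_1, …, a_n)`. -/
def errVec {n : ℕ} (θ : Fin n → ℝ) (z : Fin (n + 1) → ℤ) : Fin n → ℝ :=
  fun i => (z 0 : ℝ) * θ i - (z i.succ : ℝ)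

lemma iSup_abs_eq_norm {n : ℕ} (f : Fin n → ℝ) : ⨆ i, |f i| = ‖f‖ := by
  apply le_antisymm
  · exact Real.iSup_le (fun i => norm_le_pi_norm f i) (norm_nonneg f)
  · exact (pi_norm_le_iff_of_nonneg (Real.iSup_nonneg fun i => abs_nonneg (f i))).mpr
      fun i => le_ciSup (f := fun i => |f i|) (Set.finite_range _).bddAbove i

lemma xi_eq_norm {n : ℕ} (θ : Fin n → ℝ) (z : Fin (n + 1) → ℤ) : xi θ z = ‖errVec θ z‖ :=
  iSup_abs_eq_norm (errVec θ z)

lemma xi_nonneg {n : ℕ} (θ : Fin n → ℝ) (z : Fin (n + 1) → ℤ) : 0 ≤ xi θ z := by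
  rw [xi_eq_norm]
  exact norm_nonneg _

lemma abs_vecR_le {n : ℕ} (θ : Fin n → ℝ) {z : Fin (n + 1) → ℤ} (h0 : 0 < z 0)
    (hxi : xi θ z ≤ 1) (k : Fin (n + 1)) : |vecR z k| ≤ (‖θ‖ + 1) * z 0 := by
  have hq : (1 : ℝ) ≤ z 0 := by exact_mod_cast h0
  have hθ := norm_nonneg θ
  refine Fin.cases ?_ (fun i => ?_) k
  · rw [vecR, abs_of_pos (by linarith)]
    nlinarith
  · have h1 : |errVec θ z i| ≤ 1 := (norm_le_pi_norm _ i).trans (xi_eq_norm θ z ▸ hxi)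
    have h2 : |θ i| ≤ ‖θ‖ := norm_le_pi_norm θ i
    have h3 : vecR z i.succ = z 0 * θ i - errVec θ z i := by simp [vecR, errVec]
    rw [h3]
    calc _ ≤ |z 0 * θ i| + |errVec θ z i| := abs_sub _ _
      _ ≤ z 0 * ‖θ‖ + 1 := by
          rw [abs_mul, abs_of_pos (by linarith : (0 : ℝ) < z 0)]
          gcongr
      _ ≤ _ := by nlinarith

lemma abs_reduced_le {n : ℕ} (θ : Fin n → ℝ) {y z : Fin (n + 1) → ℤ} (hy : 0 < y 0)
    (hyz : y 0 ≤ z 0) (hxi : xi θ z ≤ xi θ y) (k : Fin (n + 1)) :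
    |vecR y k - y 0 / z 0 * vecR z k| ≤ 2 * xi θ y := by
  have hy' : (0 : ℝ) < y 0 := by exact_mod_cast hy
  have hyz' : (y 0 : ℝ) ≤ z 0 := by exact_mod_cast hyz
  have hz' : (0 : ℝ) < z 0 := by linarith
  have hx0 := xi_nonneg θ y
  refine Fin.cases ?_ (fun i => ?_) k
  · have : vecR y 0 - y 0 / z 0 * vecR z 0 = 0 := by
      simp only [vecR]; field_simp; ring
    rw [this]
    simpa using hx0
  · have h1 : |errVec θ y i| ≤ xi θ y := xi_eq_norm θ y ▸ norm_le_pi_norm (errVec θ y) i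
    have h2 : |errVec θ z i| ≤ xi θ y :=
      le_trans (xi_eq_norm θ z ▸ norm_le_pi_norm (errVec θ z) i) hxi
    have h3 : vecR y i.succ - y 0 / z 0 * vecR z i.succ =
        y 0 / z 0 * errVec θ z i - errVec θ y i := by
      simp only [vecR, errVec]; field_simp; ring
    have h4 : (y 0 : ℝ) / z 0 ≤ 1 := (div_le_one hz').mpr hyz'
    rw [h3]
    calc _ ≤ |y 0 / z 0 * errVec θ z i| + |errVec θ y i| := abs_sub _ _
      _ ≤ 1 * xi θ y + xi θ y := by
          rw [abs_mul, abs_of_pos (div_pos hy' hz')]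
          gcongr
      _ = _ := by ring

lemma covol_pair_le {n : ℕ} (θ : Fin n → ℝ) : ∃ C : ℝ, 0 < C ∧
    ∀ y z : Fin (n + 1) → ℤ, 0 < y 0 → y 0 ≤ z 0 → xi θ z ≤ xi θ y → xi θ z ≤ 1 →
      covol ![vecR y, vecR z] ≤ C * (z 0 * xi θ y) := by
  refine ⟨√((2 : ℕ).factorial * ((n + 1 : ℕ) : ℝ) ^ 2) * (2 * (‖θ‖ + 1)), by positivity, ?_⟩
  intro y z hy hyz hxi hxi1
  have hz : 0 < z 0 := by omega
  have hz' : (0 : ℝ) < z 0 := by exact_mod_cast hz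
  have hdet := det_gram_sum_smul !![1, -((y 0 : ℝ) / z 0); 0, 1] ![vecR y, vecR z]
  rw [Matrix.det_fin_two_of] at hdet
  have hle := det_gram_le
    (fun i => ∑ j, !![1, -((y 0 : ℝ) / z 0); 0, 1] i j • ![vecR y, vecR z] j)
    ![2 * xi θ y, (‖θ‖ + 1) * z 0] (by
      intro i k
      fin_cases i
      · simpa [Fin.sum_univ_two, ← sub_eq_add_neg] using abs_reduced_le θ hy hyz hxi k
      · simpa [Fin.sum_univ_two] using abs_vecR_le θ hz hxi1 k)
  rw [hdet] at hle
  simp only [Fin.prod_univ_two, Matrix.cons_val_zero, Matrix.cons_val_one] at hle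
  have hx := xi_nonneg θ y
  unfold covol
  refine (Real.sqrt_le_sqrt (le_trans (by linarith) hle)).trans (le_of_eq ?_)
  rw [Real.sqrt_mul (by positivity), Real.sqrt_sq (by positivity)]
  ring

lemma covol_triple_le {n : ℕ} (θ : Fin n → ℝ) : ∃ C : ℝ, 0 < C ∧
    ∀ x y z : Fin (n + 1) → ℤ, 0 < x 0 → 0 < y 0 → x 0 ≤ z 0 → y 0 ≤ z 0 →
      xi θ z ≤ xi θ x → xi θ z ≤ xi θ y → xi θ z ≤ 1 →
      covol ![vecR x, vecR y, vecR z] ≤ C * (z 0 * xi θ y * xi θ x) := by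
  refine ⟨√((3 : ℕ).factorial * ((n + 1 : ℕ) : ℝ) ^ 3) * (4 * (‖θ‖ + 1)), by positivity, ?_⟩
  intro x y z hx hy hxz hyz hxix hxiy hxi1
  have hz : 0 < z 0 := by omega
  have hz' : (0 : ℝ) < z 0 := by exact_mod_cast hz
  have hdet := det_gram_sum_smul
    !![1, 0, -((x 0 : ℝ) / z 0); 0, 1, -((y 0 : ℝ) / z 0); 0, 0, 1] ![vecR x, vecR y, vecR z]
  have hP : !![1, 0, -((x 0 : ℝ) / z 0); 0, 1, -((y 0 : ℝ) / z 0); 0, 0, 1].det = 1 := by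
    simp [Matrix.det_fin_three]
  rw [hP] at hdet
  have hle := det_gram_le
    (fun i => ∑ j, !![1, 0, -((x 0 : ℝ) / z 0); 0, 1, -((y 0 : ℝ) / z 0); 0, 0, 1] i j •
      ![vecR x, vecR y, vecR z] j)
    ![2 * xi θ x, 2 * xi θ y, (‖θ‖ + 1) * z 0] (by
      intro i k
      fin_cases i
      · simpa [Fin.sum_univ_three, ← sub_eq_add_neg] using abs_reduced_le θ hx hxz hxix k
      · simpa [Fin.sum_univ_three, ← sub_eq_add_neg] using abs_reduced_le θ hy hyz hxiy k
      · simpa [Fin.sum_univ_three] using abs_vecR_le θ hz hxi1 k)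
  rw [hdet] at hle
  have hB : ∏ i, ![2 * xi θ x, 2 * xi θ y, (‖θ‖ + 1) * z 0] i =
      2 * xi θ x * (2 * xi θ y) * ((‖θ‖ + 1) * z 0) := by
    simp [Fin.prod_univ_three]
  rw [hB] at hle
  have hx := xi_nonneg θ x
  have hy := xi_nonneg θ y
  unfold covol
  refine (Real.sqrt_le_sqrt (le_trans (by linarith) hle)).trans (le_of_eq ?_)
  rw [Real.sqrt_mul (by positivity), Real.sqrt_sq (by positivity)]
  ring

/-- Consecutive best approximations span a lattice of covolume `≫ q_{l+1} ξ_l`. -/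
lemma IsBestApproxSeq.le_covol {n : ℕ} {θ : Fin n → ℝ} {z : ℕ → Fin (n + 1) → ℤ}
    (hz : IsBestApproxSeq θ z) (l : ℕ) :
    z (l + 1) 0 * xi θ (z l) ≤ 4 * covol ![vecR (z l), vecR (z (l + 1))] := by
  obtain ⟨hpos, hmono, hanti, hbest⟩ := hz
  have hq0 := hpos l
  have hlt : z l 0 < z (l + 1) 0 := hmono (Nat.lt_succ_self l)
  have hxilt : xi θ (z (l + 1)) < xi θ (z l) := hanti (Nat.lt_succ_self l)
  have hb := hbest l (z (l + 1) 0 - z l 0) (by omega) (by omega)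
    (fun i => z (l + 1) i.succ - z l i.succ)
  have hsub : (fun i : Fin n => |((z (l + 1) 0 - z l 0 : ℤ) : ℝ) * θ i -
      ((z (l + 1) i.succ - z l i.succ : ℤ) : ℝ)|) =
      fun i => |(errVec θ (z (l + 1)) - errVec θ (z l)) i| := by
    ext i
    congr 1
    simp only [errVec, Pi.sub_apply]
    push_cast
    ring
  rw [hsub, iSup_abs_eq_norm, norm_sub_rev] at hb
  rw [xi_eq_norm] at hb hxilt ⊢
  rw [xi_eq_norm] at hxilt
  set e := errVec θ (z l)
  set f := errVec θ (z (l + 1))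
  have hq : (0 : ℝ) < z l 0 := by exact_mod_cast hq0
  have hqq : (z l 0 : ℝ) < z (l + 1) 0 := by exact_mod_cast hlt
  set p : ℝ := (z l 0 : ℝ)
  set q : ℝ := (z (l + 1) 0 : ℝ)
  have hv : ‖q • e - p • f‖ ≤ covol ![vecR (z l), vecR (z (l + 1))] := by
    refine (pi_norm_le_iff_of_nonneg (Real.sqrt_nonneg _)).mpr fun i => ?_
    refine le_trans (le_of_eq ?_) (abs_minor_le_covol ![vecR (z l), vecR (z (l + 1))] 0 i.succ)
    rw [Real.norm_eq_abs]
    congr 1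
    simp [e, f, errVec, vecR, p, q]
    ring
  have h1 : q * ‖e‖ - p * ‖f‖ ≤ ‖q • e - p • f‖ := by
    have := norm_sub_norm_le (q • e) (p • f)
    rwa [norm_smul, norm_smul, Real.norm_of_nonneg hq.le, Real.norm_of_nonneg (by linarith)] at this
  have h2 : p * ‖e - f‖ - (q - p) * ‖e‖ ≤ ‖q • e - p • f‖ := by
    have := norm_sub_le (q • e - p • f) ((q - p) • e)
    have h : q • e - p • f - (q - p) • e = p • (e - f) := by module
    rw [h, norm_smul, norm_smul, Real.norm_of_nonneg hq.le,
      Real.norm_of_nonneg (by linarith)] at this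
    linarith
  have he0 := norm_nonneg e
  have h3 : p * ‖f‖ ≤ p * ‖e‖ := by gcongr
  have h4 : p * ‖e‖ ≤ p * ‖e - f‖ := by gcongr
  nlinarith [mul_nonneg (sub_pos.mpr hqq).le he0]

/-- The exponent identities behind the choice of `g`, with the weights `s - w` and `t - 1 + w`. -/
lemma exponent_identities {α s t w g : ℝ} (hα0 : 0 < α) (hα1 : α < 1) (ht : 0 < t)
    (hpos : 0 ≤ (1 - α) * s + t - 1) (hw0 : 0 < w) (hw1 : w < 1)
    (hwroot : w ^ 2 - (s + 1 + α / (1 - α) * t) * w + s = 0)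
    (hg : g = α * s / ((1 - α) * (s - w))) :
    0 < s - w ∧ 0 ≤ t - 1 + w ∧ (1 - α) * (s - w) * g = α * s ∧
      (1 - α) * t * g + (1 - α) * (t - 1 + w) = t := by
  have hβ : 0 < 1 - α := by linarith
  have hprod : (1 - α) * ((1 - w) * (s - w)) = α * t * w := by
    field_simp at hwroot
    linarith
  have hsw : 0 < s - w := by
    by_contra! h
    nlinarith [mul_pos (mul_pos hα0 ht) hw0, mul_nonneg hβ.le (mul_nonneg (sub_nonneg.mpr hw1.le)
      (neg_nonneg.mpr h))]
  have hb : 0 ≤ t - 1 + w := by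
    by_contra! h
    have h1 : w < 1 - t := by linarith
    have h2 : 0 ≤ (1 - α) * (s - (1 - t)) - α * (1 - t) := by linarith
    have h3 : α * w < (1 - α) * (s - w) := by nlinarith
    have h4 : t * (α * w) < (1 - w) * ((1 - α) * (s - w)) := by
      have := mul_pos hα0 hw0
      nlinarith
    nlinarith
  have hg1 : (1 - α) * (s - w) * g = α * s := by
    rw [hg]
    field_simp
  refine ⟨hsw, hb, hg1, ?_⟩
  have : (s - w) * ((1 - α) * t * g + (1 - α) * (t - 1 + w) - t) = 0 := by
    linear_combination t * hg1 - hprod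
  rcases mul_eq_zero.mp this with h | h <;> linarith

lemma exists_growth_constant {α s t a b g : ℝ} (hα1 : α < 1) (hs : 0 < s) (ht : 0 < t)
    (ha : 0 < a) (hb : 0 ≤ b) (hab : a + b = s + t - 1)
    (hag : (1 - α) * a * g = α * s) (hbg : (1 - α) * t * g + (1 - α) * b = t)
    {C₀ C₁ C₂ : ℝ} (hC₀ : 0 < C₀) (hC₁ : 0 < C₁) (hC₂ : 0 < C₂) :
    ∃ c : ℝ, 0 < c ∧ ∀ D S T x y u v : ℝ, 0 < D → 0 ≤ S → 0 ≤ T → 0 < x → 0 < y → 0 < u → 0 < v →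
      C₀ * D ≤ S ^ s * T ^ t →
      S ≤ C₁ * D * x ^ (-α) → T ≤ C₁ * D * (v * v ^ (-α) / u) →
      D ≤ C₂ * (y * y ^ (-α)) → D ≤ C₂ * (u * u ^ (-α)) →
      c * x ^ g ≤ y ∨ c * u ^ g ≤ v := by
  have hβ : 0 < 1 - α := by linarith
  set lc := (Real.log C₀ - (s + t) * Real.log C₁ - (a + b) * Real.log C₂) /
    ((1 - α) * (a + t)) with hlc
  have hlc' : (1 - α) * (a + t) * lc =
      Real.log C₀ - (s + t) * Real.log C₁ - (a + b) * Real.log C₂ := by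
    rw [hlc]; field_simp
  refine ⟨Real.exp lc, Real.exp_pos _, ?_⟩
  intro D S T x y u v hD hS hT hx hy hu hv hmain hSle hTle hD1 hD2
  by_contra! hcon
  obtain ⟨hyx, hvu⟩ := hcon
  have hpow : ∀ {p : ℝ}, 0 < p → 0 < p ^ (-α) := fun hp => Real.rpow_pos_of_pos hp _
  have hxα := hpow hx
  have hvα := hpow hv
  have hlog_lt : ∀ {p q : ℝ}, 0 < p → 0 < q → q < Real.exp lc * p ^ g →
      Real.log q < lc + g * Real.log p := by
    intro p q hp hq h
    have := Real.log_lt_log hq h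
    rwa [Real.log_mul (Real.exp_pos _).ne' (Real.rpow_pos_of_pos hp _).ne', Real.log_exp,
      Real.log_rpow hp] at this
  have hlog_le : ∀ {p : ℝ}, 0 < p → D ≤ C₂ * (p * p ^ (-α)) →
      Real.log D ≤ Real.log C₂ + (1 - α) * Real.log p := by
    intro p hp h
    have hpα := hpow hp
    have := Real.log_le_log hD h
    rw [Real.log_mul hC₂.ne' (by positivity), Real.log_mul hp.ne' hpα.ne',
      Real.log_rpow hp] at this
    linarith
  have e1 := hlog_lt hx hy hyx
  have e2 := hlog_lt hu hv hvu
  have e3 := hlog_le hy hD1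
  have e4 := hlog_le hu hD2
  have hmain' : C₀ * D ≤ (C₁ * D * x ^ (-α)) ^ s * (C₁ * D * (v * v ^ (-α) / u)) ^ t := by
    refine hmain.trans ?_
    gcongr
  have e5 := Real.log_le_log (by positivity) hmain'
  rw [Real.log_mul hC₀.ne' hD.ne', Real.log_mul (by positivity) (by positivity),
    Real.log_rpow (by positivity), Real.log_rpow (by positivity),
    Real.log_mul (by positivity) hxα.ne', Real.log_mul hC₁.ne' hD.ne',
    Real.log_mul (by positivity) (by positivity), Real.log_mul hC₁.ne' hD.ne',
    Real.log_div (by positivity) hu.ne',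
    Real.log_mul hv.ne' hvα.ne', Real.log_rpow hx, Real.log_rpow hv] at e5
  have f1 := mul_lt_mul_of_pos_left e1 (mul_pos hβ ha)
  have f2 := mul_lt_mul_of_pos_left e2 (mul_pos hβ ht)
  have f3 := mul_le_mul_of_nonneg_left e3 ha.le
  have f4 := mul_le_mul_of_nonneg_left e4 hb
  have i1 : (1 - α) * a * (g * Real.log x) = α * s * Real.log x := by rw [← hag]; ring
  have i2 : (1 - α) * t * (g * Real.log u) = (t - (1 - α) * b) * Real.log u := by
    linear_combination Real.log u * hbg
  have i3 : (a + b) * Real.log D = (s + t - 1) * Real.log D := by rw [hab]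
  linarith

lemma latticeDet_intPoints_le {m : ℕ} {x y z : Fin m → ℤ}
    (h : LinearIndependent ℝ ![vecR x, vecR y, vecR z]) :
    latticeDet (intPoints m ⊓
      (Submodule.span ℝ ({vecR x, vecR y, vecR z} : Set (Fin m → ℝ))).toAddSubgroup) ≤
      covol ![vecR x, vecR y, vecR z] := by
  have hr : Set.range ![vecR x, vecR y, vecR z] = {vecR x, vecR y, vecR z} := by
    simp only [Matrix.range_cons, Matrix.range_empty, Set.union_empty, Set.singleton_union]
  refine latticeDet_le_covol h (fun i => ⟨?_, ?_⟩) fun p hp => ?_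
  · fin_cases i <;> exact fun j => ⟨_, rfl⟩
  · rw [← hr]
    exact Submodule.subset_span (Set.mem_range_self i)
  · rw [hr]
    exact hp.2

lemma latticeDet_closure_pair {m : ℕ} {x y : Fin m → ℝ} (h : LinearIndependent ℝ ![x, y]) :
    latticeDet (AddSubgroup.closure ({x, y} : Set (Fin m → ℝ))) = covol ![x, y] := by
  rw [← latticeDet_closure h]
  congr 2
  simp only [Matrix.range_cons, Matrix.range_empty, Set.union_empty, Set.singleton_union]

/-- The key lemma: under Schmidt-type determinant hypotheses on two triples of
consecutive best approximation vectors sharing a common 2-dimensional lattice,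
one of the two growth estimates `q_{ν+1} ≫ q_ν^g`, `q_{k+1} ≫ q_k^g` holds;
the constant `c₁` depends only on `n, θ, α, s, t, c₀`. -/
theorem statement10 {n : ℕ} (hn : 2 ≤ n) (α s t : ℝ)
    (hα0 : 0 < α) (hα1 : α < 1) (hs : 0 < s) (ht : 0 < t)
    (hpos : 0 ≤ (1 - α) * s + t - 1)
    (w : ℝ) (hw0 : 0 < w) (hw1 : w < 1)
    (hwroot : w ^ 2 - (s + 1 + α / (1 - α) * t) * w + s = 0)
    (hwmin : ∀ w' : ℝ, w' ^ 2 - (s + 1 + α / (1 - α) * t) * w' + s = 0 → w ≤ w')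
    (g : ℝ) (hg : g = α * s / ((1 - α) * (s - w)))
    (θ : Fin n → ℝ) (hθ : LinearIndependent ℚ (Fin.cons (1 : ℝ) θ : Fin (n + 1) → ℝ)) :
    ∀ c₀ : ℝ, 0 < c₀ → ∃ c₁ : ℝ, 0 < c₁ ∧
      ∀ z : ℕ → Fin (n + 1) → ℤ, IsBestApproxSeq θ z →
      ∀ ν k : ℕ, 1 ≤ ν → ν < k →
        LinearIndependent ℝ ![vecR (z (ν - 1)), vecR (z ν), vecR (z (ν + 1))] →
        LinearIndependent ℝ ![vecR (z (k - 1)), vecR (z k), vecR (z (k + 1))] →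
        AddSubgroup.closure ({vecR (z ν), vecR (z (ν + 1))} : Set (Fin (n + 1) → ℝ)) =
          AddSubgroup.closure ({vecR (z (k - 1)), vecR (z k)} : Set (Fin (n + 1) → ℝ)) →
        (∀ j ∈ ({ν - 1, ν, k - 1, k} : Set ℕ),
          xi θ (z j) ≤ (z (j + 1) 0 : ℝ) ^ (-α)) →
        c₀ * latticeDet
            (AddSubgroup.closure ({vecR (z ν), vecR (z (ν + 1))} : Set (Fin (n + 1) → ℝ))) ≤
          latticeDet (intPoints (n + 1) ⊓
              (Submodule.span ℝ ({vecR (z (ν - 1)), vecR (z ν), vecR (z (ν + 1))} :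
                Set (Fin (n + 1) → ℝ))).toAddSubgroup) ^ s *
          latticeDet (intPoints (n + 1) ⊓
              (Submodule.span ℝ ({vecR (z (k - 1)), vecR (z k), vecR (z (k + 1))} :
                Set (Fin (n + 1) → ℝ))).toAddSubgroup) ^ t →
        (c₁ * (z ν 0 : ℝ) ^ g ≤ (z (ν + 1) 0 : ℝ) ∨
          c₁ * (z k 0 : ℝ) ^ g ≤ (z (k + 1) 0 : ℝ)) := by
  obtain ⟨hsw, hb, hag, hbg⟩ := exponent_identities hα0 hα1 ht hpos hw0 hw1 hwroot hg
  obtain ⟨C₂, hC₂, hpair⟩ := covol_pair_le θ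
  obtain ⟨C₁, hC₁, htriple⟩ := covol_triple_le θ
  intro c₀ hc₀
  obtain ⟨c, hc, hgrowth⟩ := exists_growth_constant hα1 hs ht hsw hb (by ring) hag hbg hc₀
    (by positivity : 0 < C₁ * 4) hC₂
  refine ⟨c, hc, ?_⟩
  intro z hz ν k hν hνk hli₁ hli₂ hΛ hxi hdet
  obtain ⟨i, rfl⟩ : ∃ i, ν = i + 1 := ⟨ν - 1, by omega⟩
  obtain ⟨j, rfl⟩ : ∃ j, k = j + 1 := ⟨k - 1, by omega⟩
  simp only [Nat.add_sub_cancel] at *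
  have hq1 : ∀ l, (1 : ℝ) ≤ z l 0 := fun l => by exact_mod_cast hz.1 l
  have hq0 : ∀ l, (0 : ℝ) < z l 0 := fun l => by linarith [hq1 l]
  have hmono : ∀ l, z l 0 ≤ z (l + 1) 0 := fun l => (hz.2.1 (Nat.lt_succ_self l)).le
  have hanti : ∀ l, xi θ (z (l + 1)) < xi θ (z l) := fun l => hz.2.2.1 (Nat.lt_succ_self l)
  have hxi0 : ∀ l, 0 < xi θ (z l) := fun l => (xi_nonneg θ _).trans_lt (hanti l)
  have hxi₁ := hxi i (by simp)
  have hxi₂ := hxi (i + 1) (by simp)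
  have hxi₃ := hxi j (by simp)
  have hxi₄ := hxi (j + 1) (by simp)
  have hle1 : ∀ l, (z l 0 : ℝ) ^ (-α) ≤ 1 := fun l =>
    Real.rpow_le_one_of_one_le_of_nonpos (hq1 l) (by linarith)
  have hpair₁ : LinearIndependent ℝ ![vecR (z (i + 1)), vecR (z (i + 1 + 1))] :=
    (linearIndependent_finCons.mp hli₁).1
  have hpair₂ : LinearIndependent ℝ ![vecR (z j), vecR (z (j + 1))] := by
    convert hli₂.comp ![0, 1] (by decide) using 1
    ext a
    fin_cases a <;> rfl
  set D := latticeDet (AddSubgroup.closure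
    ({vecR (z (i + 1)), vecR (z (i + 1 + 1))} : Set (Fin (n + 1) → ℝ))) with hD
  have hD₁ : D = covol ![vecR (z (i + 1)), vecR (z (i + 1 + 1))] := latticeDet_closure_pair hpair₁
  have hD₂ : D = covol ![vecR (z j), vecR (z (j + 1))] := by
    rw [hD, hΛ, latticeDet_closure_pair hpair₂]
  have hlow₁ := hz.le_covol (i + 1)
  have hlow₂ := hz.le_covol j
  rw [← hD₁] at hlow₁
  rw [← hD₂] at hlow₂
  have hD0 : 0 < D := by
    have := mul_pos (hq0 (j + 1)) (hxi0 j)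
    linarith
  refine hgrowth D _ _ _ _ _ _ hD0 (latticeDet_nonneg _) (latticeDet_nonneg _) (hq0 _) (hq0 _)
    (hq0 _) (hq0 _) hdet ?_ ?_ ?_ ?_
  · calc _ ≤ _ := latticeDet_intPoints_le hli₁
      _ ≤ _ := htriple _ _ _ (hz.1 _) (hz.1 _) ((hmono _).trans (hmono _)) (hmono _)
        ((hanti _).trans (hanti _)).le (hanti _).le
        ((hanti _).le.trans (hxi₂.trans (hle1 _)))
      _ ≤ C₁ * (4 * D * (z (i + 1) 0 : ℝ) ^ (-α)) := by
        have := (hxi0 i).le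
        gcongr
      _ = _ := by ring
  · have hlow₃ : xi θ (z j) ≤ 4 * D / z (j + 1) 0 := by
      rw [le_div_iff₀ (hq0 _)]
      linarith
    calc _ ≤ _ := latticeDet_intPoints_le hli₂
      _ ≤ _ := htriple _ _ _ (hz.1 _) (hz.1 _) ((hmono _).trans (hmono _)) (hmono _)
        ((hanti _).trans (hanti _)).le (hanti _).le
        ((hanti _).le.trans (hxi₄.trans (hle1 _)))
      _ ≤ C₁ * (z (j + 1 + 1) 0 * (z (j + 1 + 1) 0 : ℝ) ^ (-α) * (4 * D / z (j + 1) 0)) := by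
        have := (hxi0 j).le
        have := (hq0 (j + 1 + 1)).le
        gcongr
      _ = _ := by ring
  · rw [hD₁]
    refine (hpair _ _ (hz.1 _) (hmono _) (hanti _).le
      ((hanti _).le.trans (hxi₂.trans (hle1 _)))).trans ?_
    have := (hq0 (i + 1 + 1)).le
    gcongr
  · rw [hD₂]
    refine (hpair _ _ (hz.1 _) (hmono _) (hanti _).le
      ((hanti _).le.trans (hxi₃.trans (hle1 _)))).trans ?_
    have := (hq0 (j + 1)).le
    gcongr

end
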